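/- For every 0 < d < 1 and ε > 0 there exists a Borel probability measure ν on the circle supported on a compact set of Hausdorff dimension less than d + ε such that |ν̂(n)| ≤ C |n|^{-d/2} for all n ≠ 0, for some constant C. -/

import Mathlib

open MeasureTheory Complex

/-- The `n`-th Fourier coefficient of a measure `μ` on the circle `ℝ/2πℤ`,
`μ̂(n) = ∫ e^{-int} dμ(t)`. -/
noncomputable def measureFourierCoeff (μ : Measure (AddCircle (2 * Real.pi))) (n : ℤ) : ℂ :=
  ∫ x, (fourier (-n) x : ℂ) ∂μ

section FourierCoefficients

variable {T : ℝ} [hT : Fact (0 < T)]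

theorem hasSum_fourierCoeff_mul {f g : AddCircle T → ℂ} (hf : Continuous f) (hg : Continuous g)
    (hs : Summable fun n => ‖fourierCoeff f n‖) (k : ℤ) :
    HasSum (fun n => fourierCoeff f n * fourierCoeff g (k - n))
      (fourierCoeff (fun x => f x * g x) k) := by
  obtain ⟨M, hM⟩ : ∃ M, ∀ x, ‖g x‖ ≤ M := by
    obtain ⟨M, hM⟩ := isCompact_univ.exists_bound_of_continuousOn hg.continuousOn
    exact ⟨M, fun x => hM x (Set.mem_univ x)⟩
  set F : ℤ → AddCircle T → ℂ :=
    fun n x => fourierCoeff f n * (fourier (-(k - n)) x * g x) with hF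
  have hFc : ∀ n, Continuous (F n) := fun n => by fun_prop
  have hFb : ∀ n x, ‖F n x‖ ≤ ‖fourierCoeff f n‖ * M := fun n x => by
    have h1 : ‖(fourier (-(k - n)) x : ℂ)‖ = 1 := Circle.norm_coe _
    rw [hF, norm_mul, norm_mul, h1, one_mul]
    gcongr
    exact hM x
  have hFi : ∀ n, Integrable (F n) AddCircle.haarAddCircle := fun n =>
    (hFc n).integrable_of_hasCompactSupport (HasCompactSupport.of_compactSpace _)
  have hsum := hasSum_integral_of_summable_integral_norm hFi
    (Summable.of_nonneg_of_le (fun n => integral_nonneg fun x => norm_nonneg _)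
      (fun n => (integral_mono (hFi n).norm (integrable_const _) (hFb n)).trans_eq (by simp))
      (hs.mul_right M))
  have hpt : ∀ x, HasSum (fun n => fourierCoeff f n • fourier n x) (f x) :=
    has_pointwise_sum_fourier_series_of_summable (f := ⟨f, hf⟩) hs.of_norm
  convert! hsum using 1
  · ext n
    simp only [hF, fourierCoeff, smul_eq_mul]
    rw [integral_const_mul]
  · simp only [fourierCoeff, smul_eq_mul]
    congr 1
    ext x
    have := ((hpt x).mul_right (fourier (-k) x * g x)).tsum_eq
    rw [← mul_assoc, mul_comm _ (f x), mul_assoc, ← this]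
    refine tsum_congr fun n => ?_
    have : (fourier (-(k - n)) x : ℂ) = fourier n x * fourier (-k) x := by
      rw [← fourier_add]
      congr 2
      ring
    simp only [hF, smul_eq_mul, this, fourierCoeff]
    ring

/-- The submultiplicative weight `(1 + |k|) ^ s` on `ℤ`. -/
noncomputable def fourierWeight (s : ℝ) (k : ℤ) : ℝ := (1 + |(k : ℝ)|) ^ s

theorem fourierWeight_pos (s : ℝ) (k : ℤ) : 0 < fourierWeight s k :=
  Real.rpow_pos_of_pos (by positivity) s

theorem one_le_fourierWeight {s : ℝ} (hs : 0 ≤ s) (k : ℤ) : 1 ≤ fourierWeight s k :=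
  Real.one_le_rpow (by simp) hs

theorem fourierWeight_le_mul {s : ℝ} (hs : 0 ≤ s) (k n : ℤ) :
    fourierWeight s k ≤ fourierWeight s n * fourierWeight s (k - n) := by
  unfold fourierWeight
  rw [← Real.mul_rpow (by positivity) (by positivity)]
  refine Real.rpow_le_rpow (by positivity) ?_ hs
  have h : |(k : ℝ)| ≤ |(n : ℝ)| + |((k - n : ℤ) : ℝ)| := by
    simpa using abs_add_le (n : ℝ) ((k - n : ℤ) : ℝ)
  nlinarith [abs_nonneg (n : ℝ), abs_nonneg ((k - n : ℤ) : ℝ)]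

theorem summable_norm_of_summable_mul_fourierWeight {s : ℝ} (hs : 0 ≤ s) {a : ℤ → ℂ}
    (ha : Summable fun n => ‖a n‖ * fourierWeight s n) : Summable fun n => ‖a n‖ :=
  ha.of_nonneg_of_le (fun _ => norm_nonneg _)
    fun n => le_mul_of_one_le_right (norm_nonneg _) (one_le_fourierWeight hs n)

theorem summable_fourierCoeff_mul {s : ℝ} (hs : 0 ≤ s) {f g : AddCircle T → ℂ}
    (hf : Continuous f) (hg : Continuous g)
    (hfs : Summable fun n => ‖fourierCoeff f n‖ * fourierWeight s n)
    (hgs : Summable fun n => ‖fourierCoeff g n‖ * fourierWeight s n) :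
    Summable fun n => ‖fourierCoeff (fun x => f x * g x) n‖ * fourierWeight s n := by
  let e : ℤ × ℤ ≃ ℤ × ℤ :=
    { toFun := fun p => (p.2, p.1 - p.2)
      invFun := fun p => (p.1 + p.2, p.1)
      left_inv := fun p => by ext <;> simp
      right_inv := fun p => by ext <;> simp }
  have hprod := hfs.mul_of_nonneg hgs
    (fun n => mul_nonneg (norm_nonneg _) (fourierWeight_pos s n).le)
    (fun n => mul_nonneg (norm_nonneg _) (fourierWeight_pos s n).le)
  have hprod' := (e.summable_iff.mpr hprod)
  have hfib := hprod'.prod_factor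
  refine hprod'.prod.of_nonneg_of_le
    (fun n => mul_nonneg (norm_nonneg _) (fourierWeight_pos s n).le) fun k => ?_
  have hk := hasSum_fourierCoeff_mul hf hg
    (summable_norm_of_summable_mul_fourierWeight hs hfs) k
  rw [← hk.tsum_eq]
  have hle : ∀ n, ‖fourierCoeff f n * fourierCoeff g (k - n)‖ * fourierWeight s k ≤
      ‖fourierCoeff f n‖ * fourierWeight s n *
        (‖fourierCoeff g (k - n)‖ * fourierWeight s (k - n)) := fun n => by
    rw [norm_mul, mul_mul_mul_comm]
    exact mul_le_mul_of_nonneg_left (fourierWeight_le_mul hs k n) (by positivity)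
  have hs1 : Summable fun n =>
      ‖fourierCoeff f n * fourierCoeff g (k - n)‖ * fourierWeight s k :=
    (hfib k).of_nonneg_of_le
      (fun n => mul_nonneg (norm_nonneg _) (fourierWeight_pos s k).le) hle
  have hs2 : Summable fun n => ‖fourierCoeff f n * fourierCoeff g (k - n)‖ := by
    simpa [mul_assoc, mul_inv_cancel₀ (fourierWeight_pos s k).ne'] using
      hs1.mul_right (fourierWeight s k)⁻¹
  calc _ ≤ (∑' n, ‖fourierCoeff f n * fourierCoeff g (k - n)‖) * fourierWeight s k :=
        mul_le_mul_of_nonneg_right (norm_tsum_le_tsum_norm hs2) (fourierWeight_pos s k).le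
    _ = ∑' n, ‖fourierCoeff f n * fourierCoeff g (k - n)‖ * fourierWeight s k :=
        tsum_mul_right.symm
    _ ≤ _ := hs1.tsum_le_tsum hle (hfib k)

theorem norm_fourierCoeff_mul_sub_le {s η : ℝ} (hs : 0 ≤ s) {f g : AddCircle T → ℂ}
    (hf : Continuous f) (hg : Continuous g)
    (hfs : Summable fun n => ‖fourierCoeff f n‖ * fourierWeight s n)
    (hg0 : fourierCoeff g 0 = 1) (hη : 0 ≤ η)
    (hgd : ∀ k ≠ 0, ‖fourierCoeff g k‖ ≤ η / fourierWeight s k) (k : ℤ) :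
    ‖fourierCoeff (fun x => f x * g x) k - fourierCoeff f k‖ ≤
      η * (∑' n, ‖fourierCoeff f n‖ * fourierWeight s n) / fourierWeight s k := by
  have hk := hasSum_fourierCoeff_mul hf hg
    (summable_norm_of_summable_mul_fourierWeight hs hfs) k
  have hk' := hk.sub (hasSum_ite_eq k (fourierCoeff f k))
  rw [mul_comm η, mul_div_assoc, ← hk'.tsum_eq]
  refine tsum_of_norm_bounded (hfs.hasSum.mul_right _) fun n => ?_
  have hw := fourierWeight_pos s
  split_ifs with h
  · subst h
    simp only [sub_self, hg0, mul_one, norm_zero]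
    have := hw n
    positivity
  · rw [sub_zero, norm_mul, mul_assoc]
    refine mul_le_mul_of_nonneg_left ((hgd (k - n) (sub_ne_zero.mpr (Ne.symm h))).trans ?_)
      (norm_nonneg _)
    rw [← mul_div_assoc, div_le_div_iff₀ (hw _) (hw _), mul_comm (fourierWeight s n), mul_assoc]
    exact mul_le_mul_of_nonneg_left (fourierWeight_le_mul hs k n) hη

theorem fourierCoeff_comp_nsmul {f : AddCircle T → ℂ} (hf : Continuous f) {q : ℕ} (hq : q ≠ 0)
    (m : ℤ) : fourierCoeff (fun x => f (q • x)) (q * m) = fourierCoeff f m := by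
  have h := Measure.measurePreserving_zsmul (AddCircle.haarAddCircle (T := T))
    (n := (q : ℤ)) (by exact_mod_cast hq)
  have hc : Continuous fun x => (fourier (-m) x : ℂ) • f x := by fun_prop
  have := integral_map (μ := AddCircle.haarAddCircle (T := T)) h.measurable.aemeasurable
    (f := fun x => (fourier (-m) x : ℂ) • f x) hc.aestronglyMeasurable
  rw [h.map_eq] at this
  rw [fourierCoeff, fourierCoeff, this]
  refine integral_congr_ae (.of_forall fun x => ?_)
  simp only [fourier_apply, natCast_zsmul]
  rw [← natCast_zsmul x q, smul_smul, neg_mul, mul_comm]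

theorem fourierCoeff_comp_nsmul_of_not_dvd (f : AddCircle T → ℂ) {q : ℕ} (hq : q ≠ 0)
    {k : ℤ} (hk : ¬ (q : ℤ) ∣ k) : fourierCoeff (fun x => f (q • x)) k = 0 := by
  have hT0 : T ≠ 0 := hT.out.ne'
  have hq' : (q : ℝ) ≠ 0 := by exact_mod_cast hq
  set a : AddCircle T := ((T / q : ℝ) : AddCircle T) with ha
  have hqa : q • a = 0 := by
    rw [ha, ← AddCircle.coe_nsmul, nsmul_eq_mul, mul_div_cancel₀ _ hq', AddCircle.coe_period]
  have hc : (fourier (-k) a : ℂ) ≠ 1 := by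
    rw [ha, fourier_coe_apply, Ne, Complex.exp_eq_one_iff]
    rintro ⟨n, hn⟩
    apply hk
    refine ⟨-n, ?_⟩
    have hT0' : (T : ℂ) ≠ 0 := by exact_mod_cast hT0
    have hq'' : (q : ℂ) ≠ 0 := by exact_mod_cast hq
    push_cast at hn
    field_simp at hn
    have : (-k : ℂ) = n * q := by
      linear_combination hn
    have : (-k : ℤ) = n * q := by exact_mod_cast this
    linarith
  have hshift := integral_add_right_eq_self (μ := AddCircle.haarAddCircle (T := T))
    (fun x => fourier (-k) x • f (q • x)) a
  have : ∀ x : AddCircle T, fourier (-k) (x + a) • f (q • (x + a)) =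
      fourier (-k) a * (fourier (-k) x • f (q • x)) := fun x => by
    have : (fourier (-k) (x + a) : ℂ) = fourier (-k) x * fourier (-k) a := by
      simp only [fourier_apply, smul_add, AddCircle.toCircle_add, Circle.coe_mul]
    rw [nsmul_add, hqa, add_zero, this, smul_eq_mul, smul_eq_mul]
    ring
  simp_rw [this, integral_const_mul] at hshift
  have h0 : ((fourier (-k) a : ℂ) - 1) * fourierCoeff (fun x => f (q • x)) k = 0 := by
    rw [sub_mul, one_mul, sub_eq_zero]
    exact hshift
  exact (mul_eq_zero.mp h0).resolve_left (sub_ne_zero.mpr hc)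

end FourierCoefficients

section Tent

theorem integral_exp_mul_tent {w : ℝ} (hw : 0 < w) {c : ℂ} (hc : c ≠ 0) :
    ∫ x in (0 : ℝ)..w, exp (c * x) * ((1 - x / w : ℝ) : ℂ) =
      (exp (c * w) - 1) / (w * c ^ 2) - 1 / c := by
  have hw' : (w : ℂ) ≠ 0 := by exact_mod_cast hw.ne'
  have hderiv : ∀ x ∈ Set.uIcc 0 w, HasDerivAt
      (fun x : ℝ => (1 - (x : ℂ) / w) * exp (c * x) / c + exp (c * x) / (w * c ^ 2))
      (exp (c * x) * ((1 - x / w : ℝ) : ℂ)) x := fun x _ => by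
    have h1 : HasDerivAt (fun x : ℝ => (x : ℂ)) 1 x := Complex.ofRealCLM.hasDerivAt
    have h2 : HasDerivAt (fun x : ℝ => exp (c * x)) (exp (c * x) * (c * 1)) x :=
      (h1.const_mul c).cexp
    have h3 := (((h1.div_const (w : ℂ)).const_sub 1).mul h2).div_const c
    convert! h3.add (h2.div_const (w * c ^ 2)) using 1
    push_cast
    field_simp
    ring
  rw [intervalIntegral.integral_eq_sub_of_hasDerivAt hderiv
    (Continuous.intervalIntegrable (by fun_prop) _ _)]
  simp only [ofReal_zero, mul_zero, Complex.exp_zero]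
  field_simp
  ring

theorem integral_tent {w : ℝ} (hw : 0 < w) :
    ∫ x in (0 : ℝ)..w, ((1 - x / w : ℝ) : ℂ) = w / 2 := by
  rw [intervalIntegral.integral_ofReal, intervalIntegral.integral_sub (by simp)
    (Continuous.intervalIntegrable (by fun_prop) _ _), intervalIntegral.integral_div,
    integral_id, intervalIntegral.integral_const]
  rw [smul_eq_mul, ← ofReal_ofNat, ← ofReal_div]
  congr 1
  field_simp
  ring

instance fact_two_pi_pos : Fact (0 < 2 * Real.pi) := ⟨Real.two_pi_pos⟩

/-- The tent function of half-width `w` on the circle, normalized to have mean one. -/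
noncomputable def circleTent (w : ℝ) (x : AddCircle (2 * Real.pi)) : ℝ :=
  2 * Real.pi / w * max 0 (1 - ‖x‖ / w)

theorem continuous_circleTent (w : ℝ) : Continuous (circleTent w) := by
  unfold circleTent
  fun_prop

theorem circleTent_nonneg {w : ℝ} (hw : 0 < w) (x : AddCircle (2 * Real.pi)) :
    0 ≤ circleTent w x := by
  unfold circleTent
  have := Real.pi_pos
  positivity

theorem norm_le_of_circleTent_ne_zero {w : ℝ} (hw : 0 < w) {x : AddCircle (2 * Real.pi)}
    (hx : circleTent w x ≠ 0) : ‖x‖ ≤ w := by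
  by_contra! h
  apply hx
  have : 1 - ‖x‖ / w ≤ 0 := by
    rw [sub_nonpos, one_le_div hw]
    exact h.le
  rw [circleTent, max_eq_left this, mul_zero]

theorem fourierCoeff_circleTent {w : ℝ} (hw : 0 < w) (hwπ : w ≤ Real.pi) (n : ℤ) :
    fourierCoeff (fun x => (circleTent w x : ℂ)) n =
      1 / w * ((∫ x in (0 : ℝ)..w, exp (n * I * x) * ((1 - x / w : ℝ) : ℂ)) +
        ∫ x in (0 : ℝ)..w, exp (-(n * I) * x) * ((1 - x / w : ℝ) : ℂ)) := by
  have hπ := Real.pi_pos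
  set h : ℝ → ℂ := fun x => fourier (-n) (x : AddCircle (2 * Real.pi)) •
    (circleTent w (x : AddCircle (2 * Real.pi)) : ℂ) with hh
  have hcont : Continuous h := by
    have := continuous_circleTent w
    have hq : Continuous fun x : ℝ => (x : AddCircle (2 * Real.pi)) :=
      AddCircle.continuous_mk' _
    fun_prop
  have hval : ∀ x : ℝ, |x| ≤ Real.pi → h x =
      2 * Real.pi / w * (exp (-(n * I) * x) * ((max 0 (1 - |x| / w) : ℝ) : ℂ)) := fun x hx => by
    have hn : ‖(x : AddCircle (2 * Real.pi))‖ = |x| := by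
      rw [AddCircle.norm_coe_eq_abs_iff _ (by positivity), abs_of_pos Real.two_pi_pos]
      linarith
    have hπ' : (Real.pi : ℂ) ≠ 0 := by exact_mod_cast hπ.ne'
    have he : (fourier (-n) (x : AddCircle (2 * Real.pi)) : ℂ) = exp (-(n * I) * x) := by
      rw [fourier_coe_apply]
      congr 1
      push_cast
      field_simp
    rw [hh]
    simp only [he, circleTent, hn, smul_eq_mul]
    push_cast
    ring
  have hhalf : ∀ (ρ : ℝ), |ρ| = 1 → ∫ x in (0 : ℝ)..Real.pi, h (ρ * x) = 2 * Real.pi / w *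
      ∫ x in (0 : ℝ)..w, exp (-(n * I) * (ρ * x : ℝ)) * ((1 - x / w : ℝ) : ℂ) := fun ρ hρ => by
    rw [← intervalIntegral.integral_add_adjacent_intervals (b := w)
      (Continuous.intervalIntegrable (by fun_prop) _ _)
      (Continuous.intervalIntegrable (by fun_prop) _ _),
      intervalIntegral.integral_congr (g := fun _ => (0 : ℂ)) (a := w),
      intervalIntegral.integral_zero, add_zero, ← intervalIntegral.integral_const_mul]
    · refine intervalIntegral.integral_congr fun x hx => ?_
      rw [Set.uIcc_of_le hw.le] at hx
      have hx' : |ρ * x| = x := by rw [abs_mul, hρ, one_mul, abs_of_nonneg hx.1]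
      rw [hval _ (by rw [hx']; linarith [hx.2]), hx', max_eq_right]
      rw [sub_nonneg, div_le_one hw]
      exact hx.2
    · intro x hx
      rw [Set.uIcc_of_le hwπ] at hx
      have hx' : |ρ * x| = x := by rw [abs_mul, hρ, one_mul, abs_of_nonneg (hw.le.trans hx.1)]
      beta_reduce
      rw [hval _ (by rw [hx']; linarith [hx.2]), hx', max_eq_left]
      · simp
      rw [sub_nonpos, one_le_div hw]
      exact hx.1
  rw [fourierCoeff_eq_intervalIntegral _ n (-Real.pi),
    show -Real.pi + 2 * Real.pi = Real.pi by ring]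
  change (1 / (2 * Real.pi)) • ∫ x in (-Real.pi)..Real.pi, h x = _
  rw [← intervalIntegral.integral_add_adjacent_intervals (b := 0)
    (hcont.intervalIntegrable _ _) (hcont.intervalIntegrable _ _)]
  have h1 := hhalf 1 (by simp)
  have h2 := hhalf (-1) (by simp)
  simp only [neg_mul, one_mul] at h1 h2
  rw [intervalIntegral.integral_comp_neg (fun x => h x), neg_zero] at h2
  rw [h1, h2, real_smul, ← mul_add]
  push_cast
  simp only [neg_mul, mul_neg, neg_neg]
  have hπ' : (Real.pi : ℂ) ≠ 0 := by exact_mod_cast hπ.ne'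
  field_simp

theorem fourierCoeff_circleTent_zero {w : ℝ} (hw : 0 < w) (hwπ : w ≤ Real.pi) :
    fourierCoeff (fun x => (circleTent w x : ℂ)) 0 = 1 := by
  have hw' : (w : ℂ) ≠ 0 := by exact_mod_cast hw.ne'
  rw [fourierCoeff_circleTent hw hwπ]
  simp only [Int.cast_zero, zero_mul, neg_zero, Complex.exp_zero, one_mul, integral_tent hw]
  field_simp
  norm_num

theorem norm_fourierCoeff_ofReal_le {T : ℝ} [Fact (0 < T)] {f : AddCircle T → ℝ}
    (hf : ∀ x, 0 ≤ f x) (n : ℤ) :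
    ‖fourierCoeff (fun x => (f x : ℂ)) n‖ ≤ ‖fourierCoeff (fun x => (f x : ℂ)) 0‖ := by
  have h1 : ∀ (m : ℤ) (x : AddCircle T), ‖(fourier m x : ℂ) • (f x : ℂ)‖ = f x := fun m x => by
    rw [norm_smul, norm_real, Real.norm_of_nonneg (hf x)]
    exact (congrArg (· * f x) (Circle.norm_coe _)).trans (one_mul _)
  refine (norm_integral_le_integral_norm _).trans_eq ?_
  simp only [h1]
  simp only [fourierCoeff, neg_zero, fourier_zero, one_smul]
  rw [integral_complex_ofReal, norm_real, Real.norm_of_nonneg (integral_nonneg hf)]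

theorem norm_fourierCoeff_circleTent_le {w : ℝ} (hw : 0 < w) (hwπ : w ≤ Real.pi) {n : ℤ}
    (hn : n ≠ 0) : ‖fourierCoeff (fun x => (circleTent w x : ℂ)) n‖ ≤ 4 / (w * |(n : ℝ)|) ^ 2 := by
  have hw' : (w : ℂ) ≠ 0 := by exact_mod_cast hw.ne'
  have hn' : (n : ℂ) ≠ 0 := by exact_mod_cast hn
  have hc : (n : ℂ) * I ≠ 0 := mul_ne_zero hn' I_ne_zero
  rw [fourierCoeff_circleTent hw hwπ, integral_exp_mul_tent hw hc,
    integral_exp_mul_tent hw (neg_ne_zero.mpr hc)]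
  have he : ∀ y : ℝ, ‖exp (y * I)‖ = 1 := norm_exp_ofReal_mul_I
  have h1 : ‖exp (n * I * w)‖ = 1 := by
    rw [← he (n * w)]
    push_cast
    ring_nf
  have h2 : ‖exp (-(n * I) * w)‖ = 1 := by
    rw [← he (-(n * w))]
    push_cast
    ring_nf
  have : 1 / (w : ℂ) * ((exp (n * I * w) - 1) / (w * (n * I) ^ 2) - 1 / (n * I) +
      ((exp (-(n * I) * w) - 1) / (w * (-(n * I)) ^ 2) - 1 / (-(n * I)))) =
      -(((exp (n * I * w) - 1) + (exp (-(n * I) * w) - 1)) / (w * n) ^ 2) := by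
    have hI : I ^ 2 = -1 := I_sq
    rw [neg_sq, mul_pow (n : ℂ) I, hI]
    field_simp
    ring
  rw [this, norm_neg, norm_div, norm_pow, norm_mul, norm_real, Real.norm_of_nonneg hw.le,
    norm_intCast]
  gcongr
  calc _ ≤ (‖exp (n * I * w)‖ + ‖(1 : ℂ)‖) + (‖exp (-(n * I) * w)‖ + ‖(1 : ℂ)‖) :=
        (norm_add_le _ _).trans (add_le_add (norm_sub_le _ _) (norm_sub_le _ _))
    _ = 4 := by
        rw [h1, h2, norm_one]
        norm_num

theorem norm_fourierCoeff_circleTent_le_rpow {w : ℝ} (hw : 0 < w) (hwπ : w ≤ Real.pi) {n : ℤ}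
    (hn : n ≠ 0) {r : ℝ} (hr0 : 0 ≤ r) (hr2 : r ≤ 2) :
    ‖fourierCoeff (fun x => (circleTent w x : ℂ)) n‖ ≤ 4 * (w * |(n : ℝ)|) ^ (-r) := by
  have hpos : 0 < w * |(n : ℝ)| := mul_pos hw (abs_pos.mpr (by exact_mod_cast hn))
  rcases le_total 1 (w * |(n : ℝ)|) with h | h
  · refine (norm_fourierCoeff_circleTent_le hw hwπ hn).trans ?_
    rw [div_eq_mul_inv, ← Real.rpow_natCast, ← Real.rpow_neg hpos.le]
    gcongr
    simpa using hr2
  · have h0 := norm_fourierCoeff_ofReal_le (circleTent_nonneg hw) n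
    rw [fourierCoeff_circleTent_zero hw hwπ, norm_one] at h0
    linarith [Real.one_le_rpow_of_pos_of_le_one_of_nonpos hpos h (neg_nonpos.mpr hr0)]

end Tent

section PrimeAverages

theorem exists_card_primeFactors_le {δ : ℝ} (hδ : 0 < δ) :
    ∃ C : ℝ, 0 < C ∧ ∀ n : ℕ, n ≠ 0 → (n.primeFactors.card : ℝ) ≤ C * (n : ℝ) ^ δ := by
  have hlog2 := Real.log_pos one_lt_two
  refine ⟨1 / (δ * Real.log 2), by positivity, fun n hn => ?_⟩
  have h1 : 2 ^ n.primeFactors.card ≤ n := by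
    refine (Finset.pow_card_le_prod _ _ _ fun p hp => ?_).trans
      (Nat.le_of_dvd (Nat.pos_of_ne_zero hn) (Nat.prod_primeFactors_dvd n))
    exact (Nat.prime_of_mem_primeFactors hp).two_le
  have h2 : (n.primeFactors.card : ℝ) * Real.log 2 ≤ Real.log n := by
    rw [← Real.log_pow]
    exact Real.log_le_log (by positivity) (by exact_mod_cast h1)
  have h3 := Real.log_le_rpow_div (Nat.cast_nonneg n) hδ
  rw [div_mul_eq_mul_div, one_mul, le_div_iff₀ (by positivity)]
  rw [le_div_iff₀ hδ] at h3
  nlinarith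

theorem tendsto_rpow_div_primeCounting {β : ℝ} (hβ : β < 1) :
    Filter.Tendsto (fun N : ℕ => (N : ℝ) ^ β / Nat.primeCounting N) Filter.atTop (nhds 0) := by
  have hlog2 := Real.log_pos one_lt_two
  have hcast := tendsto_natCast_atTop_atTop (R := ℝ)
  have hlim : Filter.Tendsto (fun N : ℕ => 2 / Real.log 2 * (Real.log N / (N : ℝ) ^ (1 - β)))
      Filter.atTop (nhds 0) := by
    simpa using! ((isLittleO_log_rpow_atTop (sub_pos.mpr hβ)).tendsto_div_nhds_zero.comp
      hcast).const_mul (2 / Real.log 2)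
  have hsmall : ∀ᶠ N : ℕ in Filter.atTop, Real.log (N + 1) ≤ N * Real.log 2 / 2 := by
    have h := ((Real.isLittleO_log_id_atTop.tendsto_div_nhds_zero).comp
      (Filter.tendsto_atTop_add_const_right _ 1 hcast)).eventually_lt_const
      (show (0 : ℝ) < Real.log 2 / 4 by positivity)
    filter_upwards [h, Filter.eventually_ge_atTop 1] with N hN hN1
    have hN1' : (1 : ℝ) ≤ N := by exact_mod_cast hN1
    simp only [Function.comp_apply, id] at hN
    rw [div_lt_iff₀ (by positivity)] at hN
    nlinarith
  refine squeeze_zero' (.of_forall fun N => by positivity) ?_ hlim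
  filter_upwards [hsmall, Filter.eventually_ge_atTop 2] with N hN hN2
  have hN2' : (2 : ℝ) ≤ N := by exact_mod_cast hN2
  have hNpos : (0 : ℝ) < N := by linarith
  have hlogN : 0 < Real.log N := Real.log_pos (by linarith)
  have hπ : N * Real.log 2 / (2 * Real.log N) ≤ Nat.primeCounting N := by
    refine le_trans ?_ (Chebyshev.pi_ge N)
    rw [← div_div]
    gcongr
    linarith
  calc (N : ℝ) ^ β / Nat.primeCounting N ≤ (N : ℝ) ^ β / (N * Real.log 2 / (2 * Real.log N)) := by
        gcongr
    _ = 2 / Real.log 2 * (Real.log N / (N : ℝ) ^ (1 - β)) := by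
        rw [Real.rpow_sub hNpos, Real.rpow_one]
        have := Real.rpow_pos_of_pos hNpos β
        field_simp

/-- The average of the dilates `x ↦ circleTent w (q • x)` over `q ∈ Q`. -/
noncomputable def tentAverage (Q : Finset ℕ) (w : ℝ) (x : AddCircle (2 * Real.pi)) : ℝ :=
  (Q.card : ℝ)⁻¹ * ∑ q ∈ Q, circleTent w (q • x)

variable {Q : Finset ℕ} {w : ℝ}

theorem continuous_tentAverage (Q : Finset ℕ) (w : ℝ) : Continuous (tentAverage Q w) := by
  have := continuous_circleTent w
  unfold tentAverage
  fun_prop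

theorem tentAverage_nonneg (hw : 0 < w) (x : AddCircle (2 * Real.pi)) : 0 ≤ tentAverage Q w x :=
  mul_nonneg (by positivity) (Finset.sum_nonneg fun _ _ => circleTent_nonneg hw _)

theorem exists_norm_nsmul_le_of_tentAverage_ne_zero (hw : 0 < w) {x : AddCircle (2 * Real.pi)}
    (hx : tentAverage Q w x ≠ 0) : ∃ q ∈ Q, ‖q • x‖ ≤ w := by
  obtain ⟨q, hq, hqx⟩ := Finset.exists_ne_zero_of_sum_ne_zero (right_ne_zero_of_mul hx)
  exact ⟨q, hq, norm_le_of_circleTent_ne_zero hw hqx⟩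

theorem fourierCoeff_tentAverage (Q : Finset ℕ) (w : ℝ) (k : ℤ) :
    fourierCoeff (fun x => (tentAverage Q w x : ℂ)) k =
      (Q.card : ℂ)⁻¹ * ∑ q ∈ Q, fourierCoeff (fun x => (circleTent w (q • x) : ℂ)) k := by
  have hc := continuous_circleTent w
  simp only [fourierCoeff]
  rw [← integral_finsetSum, ← integral_const_mul]
  · refine integral_congr_ae (.of_forall fun x => ?_)
    simp only [tentAverage, smul_eq_mul]
    push_cast
    rw [← Finset.mul_sum]
    ring
  · exact fun q _ => Continuous.integrable_of_hasCompactSupport (by fun_prop)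
      (HasCompactSupport.of_compactSpace _)

theorem fourierCoeff_tentAverage_zero (hw : 0 < w) (hwπ : w ≤ Real.pi) (hQ : Q.Nonempty)
    (hQ0 : 0 ∉ Q) : fourierCoeff (fun x => (tentAverage Q w x : ℂ)) 0 = 1 := by
  have hc : Continuous fun x => (circleTent w x : ℂ) :=
    continuous_ofReal.comp (continuous_circleTent w)
  rw [fourierCoeff_tentAverage, Finset.sum_congr rfl (g := fun _ => 1)]
  · have : (Q.card : ℂ) ≠ 0 := by exact_mod_cast hQ.card_ne_zero
    simp [this]
  · intro q hq
    have := fourierCoeff_comp_nsmul hc (q := q) (fun h => hQ0 (h ▸ hq)) 0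
    rwa [mul_zero, fourierCoeff_circleTent_zero hw hwπ] at this

theorem norm_fourierCoeff_tentAverage_le (hw : 0 < w) (hwπ : w ≤ Real.pi) {N : ℕ}
    (hQ : ∀ q ∈ Q, q ≠ 0 ∧ q ≤ N) {k : ℤ} (hk : k ≠ 0) {r : ℝ} (hr0 : 0 ≤ r) (hr2 : r ≤ 2) :
    ‖fourierCoeff (fun x => (tentAverage Q w x : ℂ)) k‖ ≤
      ((Q.filter fun q : ℕ => (q : ℤ) ∣ k).card / Q.card) * (4 * (N / (w * |(k : ℝ)|)) ^ r) := by
  have hc : Continuous fun x => (circleTent w x : ℂ) :=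
    continuous_ofReal.comp (continuous_circleTent w)
  have hk' : 0 < |(k : ℝ)| := abs_pos.mpr (by exact_mod_cast hk)
  rw [fourierCoeff_tentAverage, norm_mul, norm_inv, Complex.norm_natCast, div_mul_eq_mul_div,
    inv_mul_eq_div]
  gcongr
  rw [← nsmul_eq_mul, ← Finset.sum_filter_of_ne (p := fun q : ℕ => (q : ℤ) ∣ k)]
  · refine (norm_sum_le _ _).trans (Finset.sum_le_card_nsmul _ _ _ fun q hq => ?_)
    obtain ⟨hqQ, m, rfl⟩ := Finset.mem_filter.mp hq
    obtain ⟨hq0, hqN⟩ := hQ q hqQ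
    have hm : m ≠ 0 := right_ne_zero_of_mul hk
    have hm' : 0 < |(m : ℝ)| := abs_pos.mpr (by exact_mod_cast hm)
    rw [fourierCoeff_comp_nsmul hc hq0]
    refine (norm_fourierCoeff_circleTent_le_rpow hw hwπ hm hr0 hr2).trans ?_
    rw [Real.rpow_neg (by positivity), ← Real.inv_rpow (by positivity)]
    gcongr
    have hq0' : (0 : ℝ) < q := by exact_mod_cast Nat.pos_of_ne_zero hq0
    have hqN' : (q : ℝ) ≤ N := by exact_mod_cast hqN
    push_cast
    rw [abs_mul, Nat.abs_cast, inv_eq_one_div, div_le_div_iff₀ (by positivity) (by positivity)]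
    calc 1 * (w * (q * |(m : ℝ)|)) = q * (w * |(m : ℝ)|) := by ring
      _ ≤ N * (w * |(m : ℝ)|) := by gcongr
  · intro q hq hne
    by_contra hdvd
    exact hne (fourierCoeff_comp_nsmul_of_not_dvd (fun x => (circleTent w x : ℂ)) (hQ q hq).1 hdvd)

theorem summable_fourierCoeff_tentAverage (hw : 0 < w) (hwπ : w ≤ Real.pi) (hQ : 0 ∉ Q)
    {s : ℝ} (hs : 0 ≤ s) (hs1 : s < 1) :
    Summable fun k => ‖fourierCoeff (fun x => (tentAverage Q w x : ℂ)) k‖ * fourierWeight s k := by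
  set N := Q.sup id
  have hQ' : ∀ q ∈ Q, q ≠ 0 ∧ q ≤ N := fun q hq =>
    ⟨fun h => hQ (h ▸ hq), Finset.le_sup (f := id) hq⟩
  have hsum : Summable fun k : ℤ => 4 * (N / w) ^ (2 : ℝ) * 2 ^ s * |(k : ℝ)| ^ (-(2 - s)) :=
    (Real.summable_abs_int_rpow (by linarith)).mul_left _
  refine hsum.of_norm_bounded_eventually ?_
  rw [Filter.eventually_cofinite]
  refine (Set.finite_singleton (0 : ℤ)).subset fun k hk => ?_
  by_contra hk0
  apply hk
  have hk0 : k ≠ 0 := hk0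
  have hk1 : (1 : ℝ) ≤ |(k : ℝ)| := by exact_mod_cast Int.one_le_abs hk0
  have h1 := norm_fourierCoeff_tentAverage_le hw hwπ hQ' hk0 zero_le_two le_rfl
  have hcard : ((Q.filter fun q : ℕ => (q : ℤ) ∣ k).card : ℝ) / Q.card ≤ 1 :=
    div_le_one_of_le₀ (by exact_mod_cast Finset.card_filter_le _ _) (by positivity)
  have h2 : fourierWeight s k ≤ 2 ^ s * |(k : ℝ)| ^ s := by
    rw [fourierWeight, ← Real.mul_rpow (by positivity) (by positivity)]
    gcongr
    linarith
  rw [Real.norm_of_nonneg (mul_nonneg (norm_nonneg _) (fourierWeight_pos s k).le)]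
  calc _ ≤ (1 * (4 * (N / (w * |(k : ℝ)|)) ^ (2 : ℝ))) * (2 ^ s * |(k : ℝ)| ^ s) := by
        gcongr
        · exact (fourierWeight_pos s k).le
        · refine h1.trans ?_
          gcongr
    _ = _ := by
        rw [← div_div, Real.div_rpow (by positivity) (by positivity), neg_sub,
          Real.rpow_sub (by positivity)]
        ring

theorem exists_tentAverage {κ s η : ℝ} (hκ : 1 ≤ κ) (hs : 0 ≤ s) (hsκ : s * κ < 1) (hη : 0 < η)
    (N₀ : ℕ) : ∃ N ≥ N₀, ∃ F : AddCircle (2 * Real.pi) → ℝ, Continuous F ∧ (∀ x, 0 ≤ F x) ∧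
      (∀ x, F x ≠ 0 → ∃ q : ℕ, q ≠ 0 ∧ q ≤ N ∧ ‖q • x‖ ≤ (N : ℝ) ^ (1 - κ)) ∧
      fourierCoeff (fun x => (F x : ℂ)) 0 = 1 ∧
      (Summable fun k => ‖fourierCoeff (fun x => (F x : ℂ)) k‖ * fourierWeight s k) ∧
      ∀ k ≠ 0, ‖fourierCoeff (fun x => (F x : ℂ)) k‖ ≤ η / fourierWeight s k := by
  have hκ0 : 0 < κ := by linarith
  obtain ⟨r, hsr, hrκ⟩ : ∃ r, s < r ∧ r < 1 / κ := exists_between ((lt_div_iff₀ hκ0).mpr hsκ)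
  have hrκ' : r * κ < 1 := (lt_div_iff₀ hκ0).mp hrκ
  have hr1 : r < 1 := by nlinarith
  have hr0 : 0 < r := by linarith
  obtain ⟨C, hC, hCω⟩ := exists_card_primeFactors_le (sub_pos.mpr hsr)
  have hev := (tendsto_rpow_div_primeCounting hrκ').eventually_lt_const
    (show 0 < η / (C * 4 * 2 ^ s) by positivity)
  obtain ⟨N, hN, hN0, hN2⟩ := (hev.and ((Filter.eventually_ge_atTop N₀).and
    (Filter.eventually_ge_atTop 2))).exists
  have hNpos : (0 : ℝ) < N := by
    have : 0 < N := by omega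
    exact_mod_cast this
  set w : ℝ := (N : ℝ) ^ (1 - κ) with hwdef
  have hw : 0 < w := Real.rpow_pos_of_pos hNpos _
  have hwπ : w ≤ Real.pi := by
    have h1 : w ≤ 1 := Real.rpow_le_one_of_one_le_of_nonpos
      (by exact_mod_cast (by omega : 1 ≤ N)) (by linarith)
    linarith [Real.pi_gt_three]
  set Q := Nat.primesLE N with hQdef
  have hQ : ∀ q ∈ Q, q ≠ 0 ∧ q ≤ N := fun q hq =>
    ⟨(Nat.prime_of_mem_primesLE hq).ne_zero, Nat.le_of_mem_primesLE hq⟩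
  have hQcard : Q.card = Nat.primeCounting N := Nat.primesLE_card_eq_primeCounting N
  have hQpos : 0 < Q.card := Finset.card_pos.mpr ⟨2, Nat.mem_primesLE.mpr ⟨hN2, Nat.prime_two⟩⟩
  have hQ0 : 0 ∉ Q := fun h => (hQ 0 h).1 rfl
  refine ⟨N, hN0, tentAverage Q w, continuous_tentAverage Q w, tentAverage_nonneg hw,
    fun x hx => ?_, fourierCoeff_tentAverage_zero hw hwπ (Finset.card_pos.mp hQpos) hQ0,
    summable_fourierCoeff_tentAverage hw hwπ hQ0 hs (by linarith), fun k hk => ?_⟩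
  · obtain ⟨q, hq, hqx⟩ := exists_norm_nsmul_le_of_tentAverage_ne_zero hw hx
    exact ⟨q, (hQ q hq).1, (hQ q hq).2, hqx⟩
  have hk1 : (1 : ℝ) ≤ |(k : ℝ)| := by exact_mod_cast Int.one_le_abs hk
  have hk0 : 0 < |(k : ℝ)| := by linarith
  have hω : ((Q.filter fun q : ℕ => (q : ℤ) ∣ k).card : ℝ) ≤ C * |(k : ℝ)| ^ (r - s) := by
    have h := hCω k.natAbs (Int.natAbs_ne_zero.mpr hk)
    rw [Nat.cast_natAbs, Int.cast_abs] at h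
    refine le_trans ?_ h
    exact_mod_cast Finset.card_le_card fun q hq => by
      obtain ⟨hqQ, hqk⟩ := Finset.mem_filter.mp hq
      exact Nat.mem_primeFactors.mpr ⟨Nat.prime_of_mem_primesLE hqQ,
        Int.natCast_dvd.mp hqk, Int.natAbs_ne_zero.mpr hk⟩
  have hweight : fourierWeight s k ≤ 2 ^ s * |(k : ℝ)| ^ s := by
    rw [fourierWeight, ← Real.mul_rpow (by positivity) (by positivity)]
    gcongr
    linarith
  have hNw : (N : ℝ) / w = (N : ℝ) ^ κ := by
    rw [hwdef, ← Real.rpow_one_sub' (by positivity) (by simp; positivity)]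
    congr 1
    ring
  rw [le_div_iff₀ (fourierWeight_pos s k)]
  calc _ ≤ (C * |(k : ℝ)| ^ (r - s) / Q.card * (4 * (N / (w * |(k : ℝ)|)) ^ r)) *
          (2 ^ s * |(k : ℝ)| ^ s) := by
        gcongr
        · exact (fourierWeight_pos s k).le
        · refine (norm_fourierCoeff_tentAverage_le hw hwπ hQ hk hr0.le (by linarith)).trans ?_
          gcongr
    _ = C * 4 * 2 ^ s * ((N : ℝ) ^ (r * κ) / Nat.primeCounting N) := by
        rw [← div_div, Real.div_rpow (by positivity) (by positivity), hNw, ← Real.rpow_mul hNpos.le,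
          mul_comm κ r, hQcard, Real.rpow_sub hk0]
        have h1 := Real.rpow_pos_of_pos hk0 s
        have h2 := Real.rpow_pos_of_pos hk0 r
        field_simp
    _ ≤ C * 4 * 2 ^ s * (η / (C * 4 * 2 ^ s)) := by gcongr
    _ = η := by field_simp

end PrimeAverages

section Dimension

/-- The points `x` of the circle with `‖q • x‖ ≤ w` for some `1 ≤ q ≤ N`. -/
def nearRational (N : ℕ) (w : ℝ) : Set (AddCircle (2 * Real.pi)) :=
  {x | ∃ q : ℕ, q ≠ 0 ∧ q ≤ N ∧ ‖q • x‖ ≤ w}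

theorem isClosed_nearRational (N : ℕ) (w : ℝ) : IsClosed (nearRational N w) := by
  have : nearRational N w = ⋃ q ∈ (Finset.Icc 1 N : Set ℕ),
      {x : AddCircle (2 * Real.pi) | ‖q • x‖ ≤ w} := by
    ext x
    simp [nearRational, Nat.one_le_iff_ne_zero, and_assoc]
  rw [this]
  exact (Finset.finite_toSet _).isClosed_biUnion fun q _ =>
    isClosed_le (by fun_prop) continuous_const

theorem exists_mem_closedBall_of_norm_nsmul_le {q : ℕ} (hq : q ≠ 0) {w : ℝ}
    {x : AddCircle (2 * Real.pi)} (hx : ‖q • x‖ ≤ w) : ∃ m : ℕ, m ≤ q ∧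
      x ∈ Metric.closedBall ((2 * Real.pi * m / q : ℝ) : AddCircle (2 * Real.pi)) (w / q) := by
  have hp := Real.two_pi_pos
  have hq' : (0 : ℝ) < q := by exact_mod_cast Nat.pos_of_ne_zero hq
  obtain ⟨t, ht, rfl⟩ : ∃ t ∈ Set.Ico 0 (0 + 2 * Real.pi), (t : AddCircle (2 * Real.pi)) = x := by
    have := AddCircle.coe_image_Ico_eq (2 * Real.pi) 0
    exact (this.symm ▸ Set.mem_univ x : x ∈ _)
  rw [zero_add] at ht
  set u := (2 * Real.pi)⁻¹ * (q * t) with hu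
  have hu0 : 0 ≤ u := mul_nonneg (by positivity) (mul_nonneg hq'.le ht.1)
  have huq : u ≤ q := by
    rw [hu, inv_mul_le_iff₀ hp]
    nlinarith [ht.2]
  have hround : ((round u).toNat : ℝ) = round u := by
    have : 0 ≤ round u := by
      rw [round_eq, Int.floor_nonneg]
      linarith
    exact_mod_cast Int.toNat_of_nonneg this
  refine ⟨(round u).toNat, ?_, ?_⟩
  · have : round u ≤ (q : ℤ) := by
      rw [round_eq, ← Int.lt_add_one_iff, Int.floor_lt]
      push_cast
      linarith
    omega
  · rw [← AddCircle.coe_nsmul, nsmul_eq_mul, AddCircle.norm_eq, ← hu] at hx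
    rw [mem_closedBall_iff_norm, ← AddCircle.coe_sub, hround]
    refine (QuotientAddGroup.norm_mk_le_norm).trans ?_
    rw [Real.norm_eq_abs, le_div_iff₀ hq']
    refine le_of_eq_of_le ?_ hx
    nth_rewrite 2 [← abs_of_pos hq']
    rw [← abs_mul]
    congr 1
    field_simp

theorem dimH_le_of_subset_nearRational {κ σ : ℝ} (hκ : 1 < κ) (hσ0 : 0 < σ) (hσ1 : σ ≤ 1)
    (hκσ : 2 ≤ κ * σ) {N : ℕ → ℕ} (hN : ∀ j, j < N j) {K : Set (AddCircle (2 * Real.pi))}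
    (hK : ∀ j, K ⊆ nearRational (N j) ((N j : ℝ) ^ (1 - κ))) : dimH K ≤ ENNReal.ofReal σ := by
  set w : ℕ → ℝ := fun j => (N j : ℝ) ^ (1 - κ) with hw
  have hN1 : ∀ j, (1 : ℝ) ≤ N j := fun j => by exact_mod_cast (Nat.zero_le j).trans_lt (hN j)
  have hw0 : ∀ j, 0 < w j := fun j => Real.rpow_pos_of_pos (by linarith [hN1 j]) _
  have hwlim : Filter.Tendsto (fun j => ENNReal.ofReal (2 * w j)) Filter.atTop (nhds 0) := by
    have hNlim : Filter.Tendsto (fun j => (N j : ℝ)) Filter.atTop Filter.atTop :=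
      tendsto_natCast_atTop_atTop.comp
        (Filter.tendsto_atTop_mono (fun j => (hN j).le) Filter.tendsto_id)
    have h := (((tendsto_rpow_neg_atTop (sub_pos.mpr hκ)).comp hNlim).const_mul 2)
    rw [mul_zero] at h
    simpa [hw, Function.comp_def] using! ENNReal.tendsto_ofReal h
  let t : ∀ j, (Σ q : Fin (N j), Fin (q + 2)) → Set (AddCircle (2 * Real.pi)) := fun j i =>
    Metric.closedBall ((2 * Real.pi * (i.2 : ℕ) / ((i.1 + 1 : ℕ) : ℝ) : ℝ) :
      AddCircle (2 * Real.pi)) (w j / ((i.1 + 1 : ℕ) : ℝ))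
  have hdiam : ∀ j i, Metric.ediam (t j i) ≤
      ENNReal.ofReal (2 * w j / ((i.1 + 1 : ℕ) : ℝ)) := fun j i =>
    Metric.ediam_le_of_forall_dist_le fun x hx y hy => by
      rw [Metric.mem_closedBall] at hx hy
      rw [mul_div_assoc]
      linarith [dist_triangle_right x y
        ((2 * Real.pi * (i.2 : ℕ) / ((i.1 + 1 : ℕ) : ℝ) : ℝ) : AddCircle (2 * Real.pi))]
  have hmain := Measure.hausdorffMeasure_le_liminf_sum σ K (l := Filter.atTop) _ hwlim t
    (.of_forall fun j i => (hdiam j i).trans (ENNReal.ofReal_le_ofReal (div_le_self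
      (by linarith [hw0 j]) (by push_cast; linarith [Nat.cast_nonneg (α := ℝ) (i.1 : ℕ)]))))
    (.of_forall fun j x hx => by
      obtain ⟨q, hq0, hqN, hqx⟩ := hK j hx
      obtain ⟨m, hm, hmx⟩ := exists_mem_closedBall_of_norm_nsmul_le hq0 hqx
      obtain ⟨q, rfl⟩ := Nat.exists_eq_succ_of_ne_zero hq0
      exact Set.mem_iUnion.mpr ⟨⟨⟨q, hqN⟩, ⟨m, by simp only; omega⟩⟩, hmx⟩)
  have hsum : ∀ j, ∑ i, Metric.ediam (t j i) ^ σ ≤ 4 := fun j => by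
    have hNpos : (0 : ℝ) < N j := by linarith [hN1 j]
    have hterm : ∀ q : Fin (N j), ∑ m : Fin (q + 2), Metric.ediam (t j ⟨q, m⟩) ^ σ ≤
        ENNReal.ofReal (4 * (N j : ℝ) ^ (1 - κ * σ)) := fun q => by
      set p : ℝ := ((q + 1 : ℕ) : ℝ) with hp
      have hp1 : 1 ≤ p := by rw [hp]; push_cast; linarith [Nat.cast_nonneg (α := ℝ) (q : ℕ)]
      have hpN : p ≤ N j := by
        rw [hp]
        exact_mod_cast Nat.succ_le_of_lt q.2
      have hw0j := hw0 j
      calc _ ≤ ∑ m : Fin (q + 2), ENNReal.ofReal ((2 * w j / p) ^ σ) :=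
            Finset.sum_le_sum fun m _ => by
              rw [← ENNReal.ofReal_rpow_of_nonneg (by positivity) hσ0.le]
              exact ENNReal.rpow_le_rpow (hdiam j ⟨q, m⟩) hσ0.le
        _ = ENNReal.ofReal ((p + 1) * (2 * w j / p) ^ σ) := by
            rw [Finset.sum_const, ← ENNReal.ofReal_nsmul, nsmul_eq_mul, Finset.card_univ,
              Fintype.card_fin, hp]
            push_cast
            ring_nf
        _ ≤ _ := by
            refine ENNReal.ofReal_le_ofReal ?_
            calc (p + 1) * (2 * w j / p) ^ σ ≤ (2 * p) * (2 * w j / p) ^ σ := by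
                  gcongr
                  linarith
              _ = 2 * 2 ^ σ * (p ^ (1 - σ) * w j ^ σ) := by
                  rw [Real.div_rpow (by positivity) (by positivity),
                    Real.mul_rpow (by positivity) (by positivity), Real.rpow_sub (by positivity),
                    Real.rpow_one]
                  ring
              _ ≤ 2 * 2 ^ (1 : ℝ) * ((N j : ℝ) ^ (1 - σ) * w j ^ σ) := by
                  gcongr
                  norm_num
              _ = _ := by
                  rw [hw, ← Real.rpow_mul hNpos.le, ← Real.rpow_add hNpos,
                    show 1 - σ + (1 - κ) * σ = 1 - κ * σ by ring]
                  norm_num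
    rw [Fintype.sum_sigma]
    refine (Finset.sum_le_sum fun q _ => hterm q).trans ?_
    rw [Finset.sum_const, ← ENNReal.ofReal_nsmul, nsmul_eq_mul, Finset.card_univ,
      Fintype.card_fin]
    refine ENNReal.ofReal_le_of_le_toReal ?_
    calc (N j : ℝ) * (4 * (N j : ℝ) ^ (1 - κ * σ)) = 4 * (N j : ℝ) ^ (2 - κ * σ) := by
          rw [show 2 - κ * σ = 1 + (1 - κ * σ) by ring, Real.rpow_add hNpos, Real.rpow_one]
          ring
      _ ≤ 4 * 1 := by
          gcongr
          exact Real.rpow_le_one_of_one_le_of_nonpos (hN1 j) (by linarith)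
      _ = _ := by norm_num
  have hfin : μH[σ] K ≤ 4 :=
    hmain.trans (Filter.liminf_le_of_frequently_le' (.of_forall hsum))
  have hσ : ((⟨σ, hσ0.le⟩ : NNReal) : ℝ) = σ := rfl
  rw [ENNReal.ofReal_eq_coe_nnreal hσ0.le]
  exact dimH_le_of_hausdorffMeasure_ne_top (hfin.trans_lt (by norm_num)).ne

end Dimension

section Construction

/-- A continuous nonnegative function on the circle whose Fourier coefficients are summable
against `fourierWeight s`. -/
structure IsWeightedDensity (s : ℝ) (ψ : AddCircle (2 * Real.pi) → ℝ) : Prop where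
  continuous : Continuous ψ
  nonneg : ∀ x, 0 ≤ ψ x
  summable : Summable fun k => ‖fourierCoeff (fun x => (ψ x : ℂ)) k‖ * fourierWeight s k

theorem fourierCoeff_one (k : ℤ) :
    fourierCoeff (fun _ : AddCircle (2 * Real.pi) => ((1 : ℝ) : ℂ)) k =
      Pi.single (M := fun _ => ℂ) 0 1 k := by
  rw [← fourierCoeff_fourier (T := 2 * Real.pi) 0]
  congr 1
  ext x
  simp

theorem isWeightedDensity_one (s : ℝ) : IsWeightedDensity s fun _ => 1 where
  continuous := continuous_const
  nonneg _ := zero_le_one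
  summable := summable_of_ne_finset_zero (s := {0}) fun k hk => by
    rw [fourierCoeff_one, Pi.single_eq_of_ne (by simpa using hk), norm_zero, zero_mul]

variable {κ s : ℝ}

theorem IsWeightedDensity.exists_mul (hκ : 1 ≤ κ) (hs : 0 ≤ s) (hsκ : s * κ < 1) {η : ℝ}
    (hη : 0 < η) {ψ : AddCircle (2 * Real.pi) → ℝ} (hψ : IsWeightedDensity s ψ) (N₀ : ℕ) :
    ∃ N ≥ N₀, ∃ φ, IsWeightedDensity s φ ∧
      (∀ k, ‖fourierCoeff (fun x => (φ x : ℂ)) k - fourierCoeff (fun x => (ψ x : ℂ)) k‖ ≤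
        η / fourierWeight s k) ∧
      ∀ x, φ x ≠ 0 → ψ x ≠ 0 ∧ x ∈ nearRational N ((N : ℝ) ^ (1 - κ)) := by
  set S := ∑' k, ‖fourierCoeff (fun x => (ψ x : ℂ)) k‖ * fourierWeight s k
  have hS : 0 ≤ S := tsum_nonneg fun k => mul_nonneg (norm_nonneg _) (fourierWeight_pos s k).le
  obtain ⟨N, hN, F, hFc, hF0, hFN, hF1, hFs, hFη⟩ :=
    exists_tentAverage hκ hs hsκ (show 0 < η / (1 + S) by positivity) N₀
  have hψc : Continuous fun x => (ψ x : ℂ) := continuous_ofReal.comp hψ.continuous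
  have hFc' : Continuous fun x => (F x : ℂ) := continuous_ofReal.comp hFc
  refine ⟨N, hN, fun x => ψ x * F x, ⟨hψ.continuous.mul hFc,
    fun x => mul_nonneg (hψ.nonneg x) (hF0 x), ?_⟩, fun k => ?_, fun x hx =>
    ⟨left_ne_zero_of_mul hx, hFN x (right_ne_zero_of_mul hx)⟩⟩
  · simpa using summable_fourierCoeff_mul hs hψc hFc' hψ.summable hFs
  · have h := norm_fourierCoeff_mul_sub_le hs hψc hFc' hψ.summable hF1
      (show 0 ≤ η / (1 + S) by positivity) hFη k
    simp only [ofReal_mul]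
    refine h.trans (div_le_div_of_nonneg_right ?_ (fourierWeight_pos s k).le)
    rw [div_mul_eq_mul_div, div_le_iff₀ (by positivity)]
    nlinarith

theorem exists_seq_isWeightedDensity (hκ : 1 ≤ κ) (hs : 0 ≤ s) (hsκ : s * κ < 1) :
    ∃ (N : ℕ → ℕ) (ψ : ℕ → AddCircle (2 * Real.pi) → ℝ), (∀ j, j < N j) ∧
      (∀ j, IsWeightedDensity s (ψ j)) ∧
      (∀ j k, ‖fourierCoeff (fun x => (ψ j x : ℂ)) k - Pi.single (M := fun _ => ℂ) 0 1 k‖ ≤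
        1 / 2 / fourierWeight s k) ∧
      ∀ i j, i < j → ∀ x, ψ j x ≠ 0 → x ∈ nearRational (N i) ((N i : ℝ) ^ (1 - κ)) := by
  have hstep : ∀ (j : ℕ) (ψ : Subtype (IsWeightedDensity s)), ∃ N ≥ j + 1,
      ∃ φ : Subtype (IsWeightedDensity s), (∀ k, ‖fourierCoeff (fun x => (φ.1 x : ℂ)) k -
        fourierCoeff (fun x => (ψ.1 x : ℂ)) k‖ ≤ (1 / 2) ^ (j + 2) / fourierWeight s k) ∧
      ∀ x, φ.1 x ≠ 0 → ψ.1 x ≠ 0 ∧ x ∈ nearRational N ((N : ℝ) ^ (1 - κ)) := fun j ψ => by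
    obtain ⟨N, hN, φ, hφ, h⟩ := ψ.2.exists_mul hκ hs hsκ
      (show (0 : ℝ) < (1 / 2) ^ (j + 2) by positivity) (j + 1)
    exact ⟨N, hN, ⟨φ, hφ⟩, h⟩
  choose N hN φ hφ hφN using hstep
  let ψ : ℕ → Subtype (IsWeightedDensity s) :=
    fun j => Nat.rec ⟨_, isWeightedDensity_one s⟩ φ j
  refine ⟨fun j => N j (ψ j), fun j => (ψ j).1, fun j => hN j (ψ j), fun j => (ψ j).2,
    fun j k => ?_, fun i j hij x => ?_⟩
  · have hclose : ‖fourierCoeff (fun x => ((ψ j).1 x : ℂ)) k - Pi.single (M := fun _ => ℂ) 0 1 k‖ ≤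
        (1 / 2 - (1 / 2) ^ (j + 1)) / fourierWeight s k := by
      induction j with
      | zero =>
        rw [← fourierCoeff_one k]
        simp [ψ]
      | succ j ih =>
        refine (norm_sub_le_norm_sub_add_norm_sub _ _ _).trans
          ((add_le_add (hφ j (ψ j) k) ih).trans_eq ?_)
        ring
    refine hclose.trans (div_le_div_of_nonneg_right ?_ (fourierWeight_pos s k).le)
    have : (0 : ℝ) < (1 / 2) ^ (j + 1) := by positivity
    linarith
  · induction j, hij using Nat.le_induction with
    | base => exact fun hx => (hφN i (ψ i) x hx).2
    | succ j _ ih => exact fun hx => ih (hφN j (ψ j) x hx).1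

theorem IsWeightedDensity.exists_probabilityMeasure (hs : 0 ≤ s)
    {ψ : AddCircle (2 * Real.pi) → ℝ} (hψ : IsWeightedDensity s ψ)
    (hclose : ∀ k, ‖fourierCoeff (fun x => (ψ x : ℂ)) k - Pi.single (M := fun _ => ℂ) 0 1 k‖ ≤
      1 / 2 / fourierWeight s k) :
    ∃ μ : ProbabilityMeasure (AddCircle (2 * Real.pi)),
      (∀ k ≠ 0, ‖measureFourierCoeff μ k‖ ≤ 1 / fourierWeight s k) ∧
      (μ : Measure (AddCircle (2 * Real.pi))) {x | ψ x = 0} = 0 := by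
  set m : ℝ := ∫ x, ψ x ∂AddCircle.haarAddCircle with hm
  have hmψ : fourierCoeff (fun x => (ψ x : ℂ)) 0 = m := by
    simpa [fourierCoeff] using! integral_ofReal
  have hm2 : 1 / 2 ≤ m := by
    have h := (hclose 0).trans (div_le_self (by norm_num) (one_le_fourierWeight hs 0))
    rw [hmψ, Pi.single_eq_same, ← ofReal_one, ← ofReal_sub, norm_real, Real.norm_eq_abs] at h
    linarith [(abs_le.mp h).1]
  have hm0 : 0 < m := by linarith
  have hψi : Integrable ψ AddCircle.haarAddCircle :=
    hψ.continuous.integrable_of_hasCompactSupport (HasCompactSupport.of_compactSpace _)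
  have hρ0 : ∀ x, 0 ≤ ψ x / m := fun x => div_nonneg (hψ.nonneg x) hm0.le
  set ρ : AddCircle (2 * Real.pi) → ENNReal := fun x => ENNReal.ofReal (ψ x / m) with hρ
  have hρm : Measurable ρ := (hψ.continuous.measurable.div_const m).ennreal_ofReal
  have hprob : IsProbabilityMeasure (AddCircle.haarAddCircle.withDensity ρ) := ⟨by
    rw [withDensity_apply _ MeasurableSet.univ, Measure.restrict_univ,
      ← ofReal_integral_eq_lintegral_ofReal (hψi.div_const m) (.of_forall hρ0),
      integral_div, ← hm, div_self hm0.ne', ENNReal.ofReal_one]⟩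
  refine ⟨⟨AddCircle.haarAddCircle.withDensity ρ, hprob⟩, fun k hk => ?_, ?_⟩
  · have hcoeff : measureFourierCoeff (AddCircle.haarAddCircle.withDensity ρ) k =
        fourierCoeff (fun x => (ψ x : ℂ)) k / m := by
      rw [measureFourierCoeff, integral_withDensity_eq_integral_toReal_smul hρm
        (.of_forall fun _ => ENNReal.ofReal_lt_top), fourierCoeff, ← integral_div]
      refine integral_congr_ae (.of_forall fun x => ?_)
      simp only [hρ, ENNReal.toReal_ofReal (hρ0 x), real_smul, smul_eq_mul, ofReal_div]
      ring
    have h := hclose k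
    rw [Pi.single_eq_of_ne hk, sub_zero] at h
    rw [ProbabilityMeasure.coe_mk, hcoeff, norm_div, norm_real, Real.norm_of_nonneg hm0.le,
      div_le_iff₀ hm0]
    refine h.trans ?_
    rw [div_mul_eq_mul_div, one_mul]
    exact div_le_div_of_nonneg_right hm2 (fourierWeight_pos s k).le
  · rw [ProbabilityMeasure.coe_mk, withDensity_apply_eq_zero hρm]
    have hempty : {x | ρ x ≠ 0} ∩ {x | ψ x = 0} = ∅ := by
      ext x
      simp +contextual [hρ, imp_not_comm]
    rw [hempty, measure_empty]

theorem exists_tendsto_of_compactSpace {E : Type*} [TopologicalSpace E] [CompactSpace E]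
    (u : ℕ → E) : ∃ (L : Filter ℕ) (_ : L.NeBot) (a : E), L ≤ Filter.atTop ∧
      Filter.Tendsto u L (nhds a) :=
  ⟨Filter.hyperfilter ℕ, inferInstance, _, Nat.hyperfilter_le_atTop,
    ((Filter.hyperfilter ℕ).map u).le_nhds_lim⟩

end Construction

/-- Salem's theorem: for every `0 < d < 1` and `ε > 0` there is a probability measure
`ν` on the circle, supported on a compact set of Hausdorff dimension `< d + ε`, with
`|ν̂(n)| ≤ C |n|^{-d/2}` for all `n ≠ 0`. -/
theorem salem_measure (d ε : ℝ) (hd0 : 0 < d) (hd1 : d < 1) (hε : 0 < ε) :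
    ∃ (ν : Measure (AddCircle (2 * Real.pi))) (K : Set (AddCircle (2 * Real.pi))),
      IsProbabilityMeasure ν ∧ IsCompact K ∧ ν Kᶜ = 0 ∧
      dimH K < ENNReal.ofReal (d + ε) ∧
      ∃ C : ℝ, ∀ n : ℤ, n ≠ 0 →
        ‖measureFourierCoeff ν n‖ ≤ C * (|n| : ℝ) ^ (-(d / 2)) := by
  obtain ⟨τ, hdτ, hτ⟩ : ∃ τ, d < τ ∧ τ < min 1 (d + ε) :=
    exists_between (lt_min hd1 (by linarith))
  obtain ⟨hτ1, hτε⟩ := lt_min_iff.mp hτ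
  have hτ0 : 0 < τ := hd0.trans hdτ
  have hκ : 1 < 2 / τ := by
    rw [lt_div_iff₀ hτ0]
    linarith
  have hs : 0 ≤ d / 2 := by positivity
  have hsκ : d / 2 * (2 / τ) < 1 := by
    rw [div_mul_div_cancel₀ two_ne_zero]
    exact (div_lt_one hτ0).mpr hdτ
  obtain ⟨N, ψ, hN, hψ, hclose, hsupp⟩ := exists_seq_isWeightedDensity hκ.le hs hsκ
  choose μ hμ hμψ using fun j => (hψ j).exists_probabilityMeasure hs (hclose j)
  obtain ⟨L, _, ν, hL, hν⟩ := exists_tendsto_of_compactSpace μ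
  set A : ℕ → Set (AddCircle (2 * Real.pi)) :=
    fun j => nearRational (N j) ((N j : ℝ) ^ (1 - 2 / τ))
  have hA : ∀ j, IsClosed (A j) := fun j => isClosed_nearRational _ _
  refine ⟨ν, ⋂ j, A j, inferInstance, (isClosed_iInter hA).isCompact, ?_, ?_, 1, fun n hn => ?_⟩
  · rw [Set.compl_iInter]
    refine measure_iUnion_null fun i => le_antisymm ?_ zero_le
    refine (ProbabilityMeasure.le_liminf_measure_open_of_tendsto hν (hA i).isOpen_compl).trans ?_
    refine Filter.liminf_le_of_frequently_le' (Filter.Eventually.frequently ?_)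
    filter_upwards [hL (Filter.eventually_gt_atTop i)] with j hj
    refine (measure_mono fun x hx => ?_).trans (hμψ j).le
    by_contra h
    exact hx (hsupp i j hj x h)
  · refine (dimH_le_of_subset_nearRational hκ hτ0 hτ1.le (div_mul_cancel₀ 2 hτ0.ne').ge hN
      fun j => Set.iInter_subset A j).trans_lt ?_
    exact (ENNReal.ofReal_lt_ofReal_iff (by linarith)).mpr hτε
  · have hlim := (ProbabilityMeasure.tendsto_iff_forall_integral_rclike_tendsto ℂ).mp hν
      (BoundedContinuousFunction.mkOfCompact (fourier (-n)))
    have hle : ‖measureFourierCoeff ν n‖ ≤ 1 / fourierWeight (d / 2) n :=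
      le_of_tendsto hlim.norm (.of_forall fun j => hμ j n hn)
    have hn' : (0 : ℝ) < |(n : ℝ)| := by positivity
    refine hle.trans ?_
    rw [one_mul, Real.rpow_neg hn'.le, one_div, fourierWeight]
    exact inv_anti₀ (by positivity) (Real.rpow_le_rpow hn'.le (by linarith) hs)
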